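/- arXiv:1205.1242 — 2 statements merged into one kernel-verified Lean document; each statement's English description precedes it below -/
import Mathlib

section
/- For every general source X, the infimum 0-achievable overflow threshold satisfies R(0|X) = (1/α_c) · H̄(X), where H̄(X) = inf{ β : lim_{n→∞} Pr{ (1/n) log_K (1/P_{X^n}(X^n)) > β } = 0 } is the spectral sup-entropy rate. -/
open scoped BigOperators

/-- Cost of a string `l` over the code alphabet `Fin K`: the sum of the conditional
per-symbol costs `c (l.get i) (prefix before position i)`. -/
noncomputable def strCost {K : ℕ} (c : Fin K → List (Fin K) → ℝ) (l : List (Fin K)) : ℝ :=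
  ∑ i : Fin l.length, c (l.get i) (l.take i.val)

/-- Probability of the set `S` under the probability mass function `P`. -/
noncomputable def prSet {α : Type*} (P : α → ℝ) (S : Set α) : ℝ :=
  ∑' x, S.indicator P x

theorem strCost_nil {K : ℕ} (c : Fin K → List (Fin K) → ℝ) : strCost c [] = 0 := by
  simp [strCost]

theorem strCost_eq_sum_range {K : ℕ} (c : Fin K → List (Fin K) → ℝ) (l : List (Fin K))
    (u : Fin K) :
    strCost c l = ∑ i ∈ Finset.range l.length, c (l.getD i u) (l.take i) := by
  rw [Finset.sum_range, strCost]
  refine Finset.sum_congr rfl fun i _ => ?_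
  simp

theorem strCost_concat {K : ℕ} (c : Fin K → List (Fin K) → ℝ) (l : List (Fin K))
    (u : Fin K) : strCost c (l ++ [u]) = strCost c l + c u l := by
  rw [strCost_eq_sum_range c (l ++ [u]) u, strCost_eq_sum_range c l u, List.length_append,
    List.length_singleton, Finset.sum_range_succ]
  congr 1
  · refine Finset.sum_congr rfl fun i hi => ?_
    have hi' : i < l.length := Finset.mem_range.1 hi
    rw [List.take_append_of_le_length hi'.le, List.getD_append _ _ _ _ hi']
  · simp

theorem strCost_pos {K : ℕ} {c : Fin K → List (Fin K) → ℝ}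
    (hc : ∀ u s, 0 < c u s) {l : List (Fin K)} (hl : l ≠ []) : 0 < strCost c l := by
  have : Nonempty (Fin l.length) := ⟨⟨0, List.length_pos_iff.2 hl⟩⟩
  exact Finset.sum_pos (fun _ _ => hc _ _) Finset.univ_nonempty

/-- Every weight `q ∈ (0, 1)` is matched, up to a constant factor, by a nonempty string. -/
theorem exists_string_weight {K : ℕ} (hK : 2 ≤ K) {c : Fin K → List (Fin K) → ℝ} {cmax αc : ℝ}
    (hcmax : ∀ u s, c u s ≤ cmax) (hαc : 0 < αc)
    (hcap : ∀ s, ∑ u : Fin K, (K : ℝ) ^ (-(αc * c u s)) = 1) {q : ℝ} (hq0 : 0 < q)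
    (hq1 : q < 1) :
    ∃ l : List (Fin K), l ≠ [] ∧ (K : ℝ) ^ (-(αc * strCost c l)) ≤ q ∧
      q * (K : ℝ) ^ (-(αc * cmax)) ≤ (K : ℝ) ^ (-(αc * strCost c l)) := by
  have hK1 : (1 : ℝ) < K := by exact_mod_cast hK
  have hK0 : (0 : ℝ) < K := by linarith
  let u : Fin K := ⟨0, by omega⟩
  let v : Fin K := ⟨1, by omega⟩
  have huv : u ≠ v := by simp [u, v, Fin.ext_iff]
  set C : ℝ := (K : ℝ) ^ (-(αc * cmax))
  have hCpos : 0 < C := Real.rpow_pos_of_pos hK0 _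
  have hlow : ∀ w s, C ≤ (K : ℝ) ^ (-(αc * c w s)) := fun w s =>
    Real.rpow_le_rpow_of_exponent_le hK1.le
      (neg_le_neg (mul_le_mul_of_nonneg_left (hcmax w s) hαc.le))
  have hup : ∀ s, (K : ℝ) ^ (-(αc * c u s)) ≤ 1 - C := by
    intro s
    have h1 : ∑ w ∈ {u, v}, (K : ℝ) ^ (-(αc * c w s)) ≤ 1 := by
      rw [← hcap s]
      exact Finset.sum_le_sum_of_subset_of_nonneg (Finset.subset_univ _)
        fun _ _ _ => Real.rpow_nonneg hK0.le _
    rw [Finset.sum_pair huv] at h1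
    linarith [hlow v s]
  let f : ℕ → ℝ := fun n => (K : ℝ) ^ (-(αc * strCost c (List.replicate n u)))
  have hf0 : f 0 = 1 := by simp [f, strCost_nil]
  have hfpos : ∀ n, 0 < f n := fun n => Real.rpow_pos_of_pos hK0 _
  have hfs : ∀ n, f (n + 1) = f n * (K : ℝ) ^ (-(αc * c u (List.replicate n u))) := by
    intro n
    simp only [f]
    rw [List.replicate_succ', strCost_concat, ← Real.rpow_add hK0]
    congr 1
    ring
  have hd0 : 0 ≤ 1 - C := (Real.rpow_nonneg hK0.le _).trans (hup [])
  have hfle : ∀ n, f n ≤ (1 - C) ^ n := by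
    intro n
    induction n with
    | zero => simp [hf0]
    | succ n ih =>
      rw [hfs, pow_succ]
      exact mul_le_mul ih (hup _) (Real.rpow_nonneg hK0.le _) (pow_nonneg hd0 _)
  have hex : ∃ n, f n ≤ q := by
    obtain ⟨n, hn⟩ := exists_pow_lt_of_lt_one hq0 (show 1 - C < 1 by linarith)
    exact ⟨n, (hfle n).trans hn.le⟩
  classical
  obtain ⟨m, hm⟩ : ∃ m, Nat.find hex = m + 1 := by
    refine Nat.exists_eq_succ_of_ne_zero fun h => ?_
    have := Nat.find_spec hex
    rw [h, hf0] at this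
    linarith
  have hspec := Nat.find_spec hex
  rw [hm] at hspec
  have hprev : q < f m := not_le.1 (Nat.find_min hex (by omega))
  refine ⟨List.replicate (m + 1) u, by simp, hspec, ?_⟩
  change _ ≤ f (m + 1)
  rw [hfs]
  exact mul_le_mul hprev.le (hlow _ _) hCpos.le (hfpos m).le

section PrSet

variable {α : Type*} {P : α → ℝ}

theorem prSet_nonneg (hP : ∀ x, 0 ≤ P x) (S : Set α) : 0 ≤ prSet P S :=
  tsum_nonneg fun x => Set.indicator_nonneg (fun x _ => hP x) x

theorem prSet_mono (hP : ∀ x, 0 ≤ P x) (hs : Summable P) {S T : Set α}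
    (h : ∀ x ∈ S, 0 < P x → x ∈ T) : prSet P S ≤ prSet P T := by
  refine (hs.indicator S).tsum_le_tsum (fun x => ?_) (hs.indicator T)
  by_cases hx : x ∈ S
  · rcases (hP x).eq_or_lt with h0 | h0
    · rw [Set.indicator_of_mem hx, ← h0]
      exact Set.indicator_nonneg (fun x _ => hP x) x
    · simp [hx, h x hx h0]
  · simpa [hx] using Set.indicator_nonneg (fun x _ => hP x) x

theorem prSet_univ (hs : HasSum P 1) : prSet P Set.univ = 1 := by
  simp [prSet, hs.tsum_eq]

theorem prSet_le_one (hP : ∀ x, 0 ≤ P x) (hs : HasSum P 1) (S : Set α) : prSet P S ≤ 1 :=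
  prSet_univ hs ▸ prSet_mono hP hs.summable fun _ _ _ => Set.mem_univ _

theorem prSet_le_prSet_add (hP : ∀ x, 0 ≤ P x) (hs : Summable P) {g : α → ℝ}
    (hg : ∀ x, 0 ≤ g x) (hgs : Summable g) {S T : Set α}
    (h : ∀ x ∈ S, x ∉ T → P x ≤ g x) : prSet P S ≤ prSet P T + ∑' x, g x := by
  rw [prSet, prSet, ← (hs.indicator T).tsum_add hgs]
  refine (hs.indicator S).tsum_le_tsum (fun x => ?_) ((hs.indicator T).add hgs)
  by_cases hx : x ∈ S <;> by_cases hT : x ∈ T <;>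
    simp only [hx, hT, Set.indicator_of_mem, Set.indicator_of_notMem, not_false_eq_true]
  · linarith [hg x]
  · linarith [h x hx hT]
  · linarith [hg x, hP x]
  · linarith [hg x]

end PrSet

theorem limsup_le_zero_iff_tendsto {f : ℕ → ℝ} (h0 : ∀ n, 0 ≤ f n) (h1 : ∀ n, f n ≤ 1) :
    Filter.limsup f Filter.atTop ≤ 0 ↔ Filter.Tendsto f Filter.atTop (nhds 0) := by
  have hb : Filter.IsBoundedUnder (· ≤ ·) Filter.atTop f := Filter.isBoundedUnder_of ⟨1, h1⟩
  have hb' : Filter.IsBoundedUnder (· ≥ ·) Filter.atTop f := Filter.isBoundedUnder_of ⟨0, h0⟩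
  refine ⟨fun h => ?_, fun h => h.limsup_eq.le⟩
  exact tendsto_of_le_liminf_of_limsup_le
    (Filter.le_liminf_of_le hb.isCoboundedUnder_ge (Filter.Eventually.of_forall h0)) h hb hb'

/-- A positive perturbation of a probability mass function on a countable type that costs only a
factor `2`. -/
theorem exists_pos_subprobability {α : Type*} [Countable α] {P : α → ℝ} (hP : ∀ x, 0 ≤ P x)
    (hs : HasSum P 1) :
    ∃ Q : α → ℝ, (∀ x, 0 < Q x) ∧ (∀ x, Q x < 1) ∧ (∀ x, P x / 2 ≤ Q x) ∧ Summable Q ∧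
      ∑' x, Q x ≤ 1 := by
  have : Encodable α := Encodable.ofCountable α
  obtain ⟨w, hw, a, ha, haw⟩ := posSumOfEncodable (ε := 1 / 4) (by norm_num) α
  have hsum := (hs.div_const 2).add ha
  refine ⟨fun x => P x / 2 + w x, fun x => by linarith [hP x, hw x], fun x => ?_,
    fun x => by linarith [hw x], hsum.summable, hsum.tsum_eq.trans_le (by linarith)⟩
  linarith [le_hasSum hs x fun y _ => hP y, le_hasSum ha x fun y _ => (hw y).le]

theorem sInf_eq_inv_mul_sInf {A B : Set ℝ} {a : ℝ} (ha : 0 < a) (hA : BddBelow A)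
    (hB : BddBelow B) (hAB : ∀ r ∈ A, ∀ γ > 0, a * r + γ ∈ B)
    (hBA : ∀ β ∈ B, ∀ γ > 0, β / a + γ ∈ A) : sInf A = (1 / a) * sInf B := by
  rcases A.eq_empty_or_nonempty with rfl | hne
  · have : B = ∅ := Set.eq_empty_of_forall_notMem fun β hβ => hBA β hβ 1 one_pos
    simp [this]
  have hneB : B.Nonempty := hne.elim fun r hr => ⟨_, hAB r hr 1 one_pos⟩
  apply le_antisymm
  · rw [one_div_mul_eq_div, le_div_iff₀ ha]
    refine le_csInf hneB fun β hβ => ?_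
    rw [← le_div_iff₀ ha]
    exact le_of_forall_pos_le_add fun γ hγ => csInf_le hA (hBA β hβ γ hγ)
  · rw [one_div_mul_eq_div]
    refine le_csInf hne fun r hr => ?_
    rw [div_le_iff₀' ha]
    exact le_of_forall_pos_le_add fun γ hγ => csInf_le hB (hAB r hr γ hγ)

theorem lt_one_div_mul_logb_iff {b p β : ℝ} {n : ℕ} (hb : 1 < b) (hp : 0 < p) (hn : 0 < n) :
    β < (1 / (n : ℝ)) * Real.logb b (1 / p) ↔ p < b ^ (-(n * β)) := by
  have hn' : (0 : ℝ) < n := by exact_mod_cast hn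
  rw [one_div_mul_eq_div, lt_div_iff₀' hn', Real.lt_logb_iff_rpow_lt hb (by positivity),
    lt_one_div (Real.rpow_pos_of_pos (by linarith) _) hp, Real.rpow_neg (by linarith), one_div]

theorem tendsto_rpow_neg_natCast_mul {b γ : ℝ} (hb : 1 < b) (hγ : 0 < γ) :
    Filter.Tendsto (fun n : ℕ => b ^ (-(n * γ))) Filter.atTop (nhds 0) := by
  have hb0 : 0 < b := by linarith
  have h : ∀ n : ℕ, b ^ (-(n * γ)) = (b ^ (-γ)) ^ n := fun n => by
    rw [← Real.rpow_mul_natCast hb0.le]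
    congr 1
    ring
  simp only [h]
  exact tendsto_pow_atTop_nhds_zero_of_lt_one (Real.rpow_nonneg hb0.le _)
    (Real.rpow_lt_one_of_one_lt_of_neg hb (by linarith))

/-- Converse part: an overflow estimate for a single code satisfying the Kraft inequality. -/
theorem prSet_logb_gt_le {α : Type*} {P : α → ℝ} (hP : ∀ x, 0 ≤ P x) (hs : Summable P)
    {b a R γ : ℝ} {n : ℕ} (hb : 1 < b) (ha : 0 < a) (hn : 0 < n) {cost : α → ℝ}
    (hkraft : ∑' x, ENNReal.ofReal (b ^ (-(a * cost x))) ≤ 1) :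
    prSet P {x | (1 / (n : ℝ)) * Real.logb b (1 / P x) > a * R + γ} ≤
      prSet P {x | cost x > n * R} + b ^ (-(n * γ)) := by
  have hb0 : 0 < b := by linarith
  have hw : ∀ x, 0 ≤ b ^ (-(a * cost x)) := fun x => Real.rpow_nonneg hb0.le _
  have hsw : Summable fun x => b ^ (-(a * cost x)) := by
    have := ENNReal.summable_toReal (ne_top_of_le_ne_top ENNReal.one_ne_top hkraft)
    simpa only [ENNReal.toReal_ofReal (hw _)] using this
  have hle : ∑' x, b ^ (-(a * cost x)) ≤ 1 := by
    rwa [← ENNReal.ofReal_tsum_of_nonneg hw hsw, ENNReal.ofReal_le_one] at hkraft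
  have hγ0 : 0 ≤ b ^ (-(n * γ)) := Real.rpow_nonneg hb0.le _
  refine (prSet_le_prSet_add (T := {x | cost x > n * R}) hP hs
    (fun x => mul_nonneg hγ0 (hw x)) (hsw.mul_left _) ?_).trans ?_
  · intro x hx hxT
    rcases (hP x).eq_or_lt with h0 | h0
    · rw [← h0]
      exact mul_nonneg hγ0 (hw x)
    · refine ((lt_one_div_mul_logb_iff hb h0 hn).1 hx).le.trans ?_
      rw [← Real.rpow_add hb0]
      refine Real.rpow_le_rpow_of_exponent_le hb.le ?_
      have : a * cost x ≤ a * (n * R) := mul_le_mul_of_nonneg_left (not_lt.1 hxT) ha.le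
      linarith
  · rw [tsum_mul_left]
    linarith [mul_le_mul_of_nonneg_left hle hγ0]

/-- Achievability part: a code satisfying the Kraft inequality whose weights dominate the given
probability mass function up to a constant. -/
theorem exists_code_of_pmf {K : ℕ} (hK : 2 ≤ K) {c : Fin K → List (Fin K) → ℝ} {cmax αc : ℝ}
    (hcmax : ∀ u s, c u s ≤ cmax) (hαc : 0 < αc)
    (hcap : ∀ s, ∑ u : Fin K, (K : ℝ) ^ (-(αc * c u s)) = 1)
    {α : Type*} [Countable α] {P : α → ℝ} (hP : ∀ x, 0 ≤ P x) (hs : HasSum P 1) :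
    ∃ φ : α → List (Fin K), (∀ x, φ x ≠ []) ∧
      ∑' x, ENNReal.ofReal ((K : ℝ) ^ (-(αc * strCost c (φ x)))) ≤ 1 ∧
      ∀ x, P x / 2 * (K : ℝ) ^ (-(αc * cmax)) ≤ (K : ℝ) ^ (-(αc * strCost c (φ x))) := by
  obtain ⟨Q, hQ0, hQ1, hPQ, hQs, hQle⟩ := exists_pos_subprobability hP hs
  choose φ hne hle hge using fun x =>
    exists_string_weight hK hcmax hαc hcap (hQ0 x) (hQ1 x)
  refine ⟨φ, hne, ?_, fun x => (mul_le_mul_of_nonneg_right (hPQ x)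
    (Real.rpow_nonneg (Nat.cast_nonneg K) _)).trans (hge x)⟩
  calc ∑' x, ENNReal.ofReal ((K : ℝ) ^ (-(αc * strCost c (φ x))))
      ≤ ∑' x, ENNReal.ofReal (Q x) :=
        ENNReal.tsum_le_tsum fun x => ENNReal.ofReal_le_ofReal (hle x)
    _ = ENNReal.ofReal (∑' x, Q x) :=
        (ENNReal.ofReal_tsum_of_nonneg (fun x => (hQ0 x).le) hQs).symm
    _ ≤ 1 := ENNReal.ofReal_le_one.2 hQle

/-- Corollary 1: the infimum `0`-achievable overflow threshold equals
`(1/αc) · H̄(X)`, where `H̄(X)` is the spectral sup-entropy rate, i.e. the infimum of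
all `β` such that `Pr{ (1/n) log_K (1/P_{X^n}(X^n)) > β } → 0`. -/
theorem zero_achievable_threshold_eq_sup_entropy_rate
    (K : ℕ) (hK : 2 ≤ K)
    (c : Fin K → List (Fin K) → ℝ) (cmax αc : ℝ)
    (hcpos : ∀ (u : Fin K) (s : List (Fin K)), 0 < c u s)
    (hcmax : ∀ (u : Fin K) (s : List (Fin K)), c u s ≤ cmax)
    (hαc : 0 < αc)
    (hcap : ∀ s : List (Fin K), ∑ u : Fin K, (K : ℝ) ^ (-(αc * c u s)) = 1)
    (𝓧 : Type) [Countable 𝓧]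
    (P : (n : ℕ) → (Fin n → 𝓧) → ℝ)
    (hPnn : ∀ n x, 0 ≤ P n x) (hPsum : ∀ n, HasSum (P n) 1) :
    sInf {R : ℝ | ∃ φ : (n : ℕ) → (Fin n → 𝓧) → List (Fin K),
        (∀ n x, φ n x ≠ []) ∧
        (∀ n, ∑' x, ENNReal.ofReal ((K : ℝ) ^ (-(αc * strCost c (φ n x)))) ≤ 1) ∧
        Filter.limsup
          (fun n => prSet (P n) {x | strCost c (φ n x) > (n : ℝ) * R})
          Filter.atTop ≤ (0 : ℝ)}
    = (1 / αc) *
      sInf {β : ℝ |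
        Filter.Tendsto
          (fun n : ℕ => prSet (P n)
            {x | (1 / (n : ℝ)) * Real.logb K (1 / P n x) > β})
          Filter.atTop (nhds 0)} := by
  have hK1 : (1 : ℝ) < K := by exact_mod_cast hK
  have hK0 : (0 : ℝ) < K := by linarith
  have hone : ¬ Filter.Tendsto (fun _ : ℕ => (1 : ℝ)) Filter.atTop (nhds 0) := fun h =>
    one_ne_zero (tendsto_nhds_unique tendsto_const_nhds h)
  have hlim : ∀ S : (n : ℕ) → Set (Fin n → 𝓧),
      Filter.limsup (fun n => prSet (P n) (S n)) Filter.atTop ≤ (0 : ℝ) ↔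
        Filter.Tendsto (fun n => prSet (P n) (S n)) Filter.atTop (nhds 0) := fun S =>
    limsup_le_zero_iff_tendsto (fun n => prSet_nonneg (hPnn n) _)
      fun n => prSet_le_one (hPnn n) (hPsum n) _
  refine sInf_eq_inv_mul_sInf hαc ⟨0, ?_⟩ ⟨0, ?_⟩ ?_ ?_
  · rintro R ⟨φ, hne, -, hφ⟩
    by_contra! hR
    rw [hlim] at hφ
    refine hone (hφ.congr fun n => ?_)
    refine (congrArg (prSet (P n)) (Set.eq_univ_of_forall fun x => ?_)).trans
      (prSet_univ (hPsum n))
    exact (mul_nonpos_of_nonneg_of_nonpos n.cast_nonneg hR.le).trans_lt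
      (strCost_pos hcpos (hne n x))
  · intro β hβ
    by_contra! hβ0
    refine hone (Filter.Tendsto.congr (fun n => ?_) hβ)
    refine (congrArg (prSet (P n)) (Set.eq_univ_of_forall fun x =>
      hβ0.trans_le (mul_nonneg (by positivity) ?_))).trans (prSet_univ (hPsum n))
    rcases (hPnn n x).eq_or_lt with h0 | h0
    · simp [← h0]
    · exact Real.logb_nonneg hK1
        ((one_le_div h0).2 (le_hasSum (hPsum n) x fun y _ => hPnn n y))
  · rintro R ⟨φ, -, hkraft, hφ⟩ γ hγ
    rw [hlim] at hφ
    have hbound := hφ.add (tendsto_rpow_neg_natCast_mul hK1 hγ)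
    rw [add_zero] at hbound
    refine tendsto_of_tendsto_of_tendsto_of_le_of_le' tendsto_const_nhds hbound
      (Filter.Eventually.of_forall fun n => prSet_nonneg (hPnn n) _) ?_
    filter_upwards [Filter.eventually_gt_atTop 0] with n hn
    exact prSet_logb_gt_le (hPnn n) (hPsum n).summable hK1 hαc hn (hkraft n)
  · intro β hβ γ hγ
    choose φ hne hkraft hge using fun n =>
      exists_code_of_pmf hK hcmax hαc hcap (hPnn n) (hPsum n)
    refine ⟨φ, hne, hkraft, ?_⟩
    rw [hlim]
    refine tendsto_of_tendsto_of_tendsto_of_le_of_le' tendsto_const_nhds hβ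
      (Filter.Eventually.of_forall fun n => prSet_nonneg (hPnn n) _) ?_
    set C : ℝ := (K : ℝ) ^ (-(αc * cmax))
    have hC : 0 < C := Real.rpow_pos_of_pos hK0 _
    filter_upwards [Filter.eventually_gt_atTop 0,
      (tendsto_rpow_neg_natCast_mul hK1 (mul_pos hαc hγ)).eventually_lt_const (half_pos hC)]
      with n hn hsmall
    refine prSet_mono (hPnn n) (hPsum n).summable fun x hx hpx => ?_
    refine (lt_one_div_mul_logb_iff hK1 hpx hn).2 ?_
    have hcost : αc * (n * (β / αc + γ)) < αc * strCost c (φ n x) :=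
      mul_lt_mul_of_pos_left hx hαc
    have hexp : αc * (n * (β / αc + γ)) = n * β + n * (αc * γ) := by
      field_simp
    have hlt : P n x / 2 * C < (K : ℝ) ^ (-(n * β)) * (C / 2) :=
      calc P n x / 2 * C ≤ (K : ℝ) ^ (-(αc * strCost c (φ n x))) := hge n x
        _ ≤ (K : ℝ) ^ (-(n * β) + -(n * (αc * γ))) :=
          Real.rpow_le_rpow_of_exponent_le hK1.le (by linarith)
        _ = (K : ℝ) ^ (-(n * β)) * (K : ℝ) ^ (-(n * (αc * γ))) := Real.rpow_add hK0 _ _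
        _ < _ := mul_lt_mul_of_pos_left hsmall (Real.rpow_pos_of_pos hK0 _)
    refine lt_of_mul_lt_mul_right (a := C / 2) ?_ (half_pos hC).le
    linarith
end

section
/- Let P be a probability mass function on the countable set 𝒳^n and let the conditional cost function have constant cost capacity α_c > 0. Then there exists an injective variable-length encoder φ : 𝒳^n → 𝒰* satisfying the cost Kraft inequality Σ_{x∈𝒳^n} K^{−α_c c(φ(x))} ≤ 1 such that for every x ∈ 𝒳^n with P(x) > 0, the codeword cost satisfies c(φ(x)) ≤ −(1/α_c) log_K P(x) + (log_K 2)/α_c + c_max. -/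
open scoped BigOperators

section CodeTree

variable {σ : Type*} [Fintype σ]

open Classical in
/-- The one-symbol extensions of `t` partition the strings properly extending `t`. -/
theorem sum_sum_filter_append_prefix_le {w : List σ → ℝ} (hw : ∀ s, 0 ≤ w s)
    (F : Finset (List σ)) (t : List σ) :
    ∑ u : σ, ∑ s ∈ F with t ++ [u] <+: s, w s ≤ ∑ s ∈ F with t <+: s, w s := by
  rw [← Finset.sum_biUnion]
  · refine Finset.sum_le_sum_of_subset_of_nonneg (fun s hs => ?_) fun s _ _ => hw s
    simp only [Finset.mem_biUnion, Finset.mem_univ, true_and, Finset.mem_filter] at hs ⊢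
    obtain ⟨u, hsF, hu⟩ := hs
    exact ⟨hsF, (List.prefix_append t [u]).trans hu⟩
  · intro u _ v _ huv
    rw [Function.onFun, Finset.disjoint_left]
    intro s hsu hsv
    have h := List.prefix_of_prefix_length_le (Finset.mem_filter.1 hsu).2
      (Finset.mem_filter.1 hsv).2 (by simp)
    have h' := h.eq_of_length (by simp)
    exact huv (by simpa using h')

/-- In a tree whose weights are split at each node, every child receiving at least a fraction `r`
of its parent, a finite set of strings of total weight less than `1` misses some string whose
weight lies in `[r * p, p]`. -/
theorem exists_weight_mem_Icc_notMem [Nontrivial σ] {w : List σ → ℝ} {r p : ℝ}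
    (hw : ∀ s, 0 < w s) (hnil : w [] = 1) (hsum : ∀ t, ∑ u, w (t ++ [u]) = w t)
    (hr : 0 < r) (hchild : ∀ t u, r * w t ≤ w (t ++ [u])) (hp : 0 < p) (hp1 : p < 1)
    (F : Finset (List σ)) (hF : ∑ s ∈ F, w s < 1) :
    ∃ s, s ≠ [] ∧ w s ∈ Set.Icc (r * p) p ∧ s ∉ F := by
  classical
  have hshrink : ∀ t u, w (t ++ [u]) ≤ (1 - r) * w t := by
    intro t u
    obtain ⟨v, hv⟩ := exists_ne u
    have h := Finset.add_le_sum (s := Finset.univ) (f := fun u => w (t ++ [u]))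
      (fun i _ => (hw _).le) (Finset.mem_univ u) (Finset.mem_univ v) hv.symm
    linarith [hsum t, hchild t v]
  have hρ : 0 ≤ 1 - r := by
    obtain ⟨u⟩ := (inferInstance : Nonempty σ)
    have := hshrink [] u
    rw [hnil, mul_one] at this
    exact (hw _).le.trans this
  have descend : ∀ n : ℕ, ∀ t, p < w t → w t * (1 - r) ^ n ≤ p →
      ∑ s ∈ F with t <+: s, w s < w t →
      ∃ s, s ≠ [] ∧ w s ∈ Set.Icc (r * p) p ∧ s ∉ F := by
    intro n
    induction n with
    | zero =>
      intro t h1 h2 _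
      rw [pow_zero, mul_one] at h2
      exact absurd h2 h1.not_ge
    | succ n ih =>
      intro t h1 h2 h3
      obtain ⟨u, -, hu⟩ := Finset.exists_lt_of_sum_lt
        (((sum_sum_filter_append_prefix_le (fun s => (hw s).le) F t).trans_lt h3).trans_eq
          (hsum t).symm)
      by_cases hle : w (t ++ [u]) ≤ p
      · refine ⟨t ++ [u], by simp, ⟨?_, hle⟩, fun hmem => hu.not_ge ?_⟩
        · exact (mul_le_mul_of_nonneg_left h1.le hr.le).trans (hchild t u)
        · exact Finset.single_le_sum (f := w) (fun s _ => (hw s).le)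
            (Finset.mem_filter.2 ⟨hmem, List.prefix_rfl⟩)
      · refine ih _ (not_le.1 hle) ?_ hu
        calc w (t ++ [u]) * (1 - r) ^ n ≤ (1 - r) * w t * (1 - r) ^ n := by
              gcongr
              exact hshrink t u
          _ = w t * (1 - r) ^ (n + 1) := by ring
          _ ≤ p := h2
  obtain ⟨n, hn⟩ := exists_pow_lt_of_lt_one hp (by linarith : 1 - r < 1)
  exact descend n [] (by rwa [hnil]) (by rw [hnil, one_mul]; exact hn.le)
    (by simpa [hnil] using hF)

end CodeTree

/-- Greedy choice of an injective selection from a countable family of sets. -/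
theorem exists_injective_mem_of_forall_finset {α β : Type*} [Countable α] [Nonempty β] (G : α → Set β)
    (h : ∀ (x : α) (T : Finset α) (f : α → β), (∀ y ∈ T, f y ∈ G y) →
      ∃ s ∈ G x, ∀ y ∈ T, s ≠ f y) :
    ∃ f : α → β, Function.Injective f ∧ ∀ x, f x ∈ G x := by
  classical
  obtain ⟨e, he⟩ := exists_injective_nat α
  have hfin : ∀ x, {y | e y < e x}.Finite := fun x =>
    (Set.finite_Iio (e x)).preimage he.injOn
  have step : ∀ (x : α) (g : ∀ y, e y < e x → G y),
      ∃ s : G x, ∀ y (hy : e y < e x), (s : β) ≠ g y hy := by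
    intro x g
    obtain ⟨s, hs, hne⟩ := h x (hfin x).toFinset
      (fun y => if hy : e y < e x then g y hy else Classical.arbitrary β) fun y hy => by
        have hy' : e y < e x := by simpa using hy
        simp [hy']
    refine ⟨⟨s, hs⟩, fun y hy => ?_⟩
    simpa [hy] using hne y (by simpa using hy)
  choose next hnext using step
  let f : ∀ x, G x := (measure e).wf.fix next
  have hf : ∀ x y, e y < e x → (f x : β) ≠ f y := by
    intro x y hy
    have : f x = next x fun y _ => f y := (measure e).wf.fix_eq next x
    rw [this]
    exact hnext x _ y hy
  refine ⟨fun x => f x, fun x y hxy => he ?_, fun x => (f x).2⟩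
  rcases lt_trichotomy (e x) (e y) with hlt | heq | hlt
  · exact absurd hxy.symm (hf y x hlt)
  · exact heq
  · exact absurd hxy (hf x y hlt)

theorem strCost_append_singleton {K : ℕ} (c : Fin K → List (Fin K) → ℝ) (t : List (Fin K))
    (u : Fin K) : strCost c (t ++ [u]) = strCost c t + c u t := by
  have hlen : (t ++ [u]).length = t.length + 1 := by simp
  unfold strCost
  rw [← Equiv.sum_comp (finCongr hlen.symm), Fin.sum_univ_castSucc]
  congr 1
  · refine Finset.sum_congr rfl fun i _ => ?_
    simp [List.take_append_of_le_length i.2.le]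
  · simp

/-- Existence of a good code (Han–Uchida): there is an injective encoder into nonempty
strings satisfying the cost Kraft inequality whose codeword costs satisfy
`c(φ(x)) ≤ −(1/αc) log_K P(x) + (log_K 2)/αc + c_max` for all `x` with `P(x) > 0`. -/
theorem exists_good_cost_code
    (K : ℕ) (hK : 2 ≤ K)
    (c : Fin K → List (Fin K) → ℝ) (cmax αc : ℝ)
    (hcpos : ∀ (u : Fin K) (s : List (Fin K)), 0 < c u s)
    (hcmax : ∀ (u : Fin K) (s : List (Fin K)), c u s ≤ cmax)
    (hαc : 0 < αc)
    (hcap : ∀ s : List (Fin K), ∑ u : Fin K, (K : ℝ) ^ (-(αc * c u s)) = 1)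
    (α : Type) [Countable α]
    (P : α → ℝ) (hPnn : ∀ x, 0 ≤ P x) (hPsum : HasSum P 1) :
    ∃ φ : α → List (Fin K),
      Function.Injective φ ∧ (∀ x, φ x ≠ []) ∧
      (∑' x, ENNReal.ofReal ((K : ℝ) ^ (-(αc * strCost c (φ x)))) ≤ 1) ∧
      ∀ x, 0 < P x →
        strCost c (φ x)
          ≤ -(1 / αc) * Real.logb K (P x) + Real.logb K 2 / αc + cmax := by
  have hK1 : (1 : ℝ) < K := by exact_mod_cast hK
  have hK0 : (0 : ℝ) < K := by linarith
  have : Nontrivial (Fin K) := Fin.nontrivial_iff_two_le.2 hK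
  set w : List (Fin K) → ℝ := fun s => (K : ℝ) ^ (-(αc * strCost c s)) with hw_def
  set r : ℝ := (K : ℝ) ^ (-(αc * cmax)) with hr_def
  have hw : ∀ s, 0 < w s := fun s => Real.rpow_pos_of_pos hK0 _
  have hr : 0 < r := Real.rpow_pos_of_pos hK0 _
  have hnil : w [] = 1 := by simp [hw_def, strCost_nil]
  have happend : ∀ t u, w (t ++ [u]) = w t * (K : ℝ) ^ (-(αc * c u t)) := by
    intro t u
    simp only [hw_def, strCost_append_singleton, ← Real.rpow_add hK0]
    ring_nf
  have hsum : ∀ t, ∑ u, w (t ++ [u]) = w t := by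
    intro t
    simp only [happend, ← Finset.mul_sum, hcap, mul_one]
  have hchild : ∀ t u, r * w t ≤ w (t ++ [u]) := by
    intro t u
    rw [happend, mul_comm]
    refine mul_le_mul_of_nonneg_left (Real.rpow_le_rpow_of_exponent_le hK1.le ?_) (hw t).le
    have := mul_le_mul_of_nonneg_left (hcmax u t) hαc.le
    linarith
  -- A strictly positive sub-probability dominating `P / 2`.
  have := Encodable.ofCountable α
  obtain ⟨ε, hε, a, hεsum, ha⟩ := posSumOfEncodable (by norm_num : (0 : ℝ) < 1 / 4) α
  set Q : α → ℝ := fun x => P x / 2 + ε x with hQ_def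
  have hQsum : HasSum Q (1 / 2 + a) := (hPsum.div_const 2).add hεsum
  have hQpos : ∀ x, 0 < Q x := fun x => by
    have := hPnn x
    have := hε x
    simp only [hQ_def]
    linarith
  have hQfin : ∀ T : Finset α, ∑ x ∈ T, Q x < 1 := fun T =>
    (sum_le_hasSum T (fun x _ => (hQpos x).le) hQsum).trans_lt (by linarith)
  have hQ1 : ∀ x, Q x < 1 := fun x => by simpa using hQfin {x}
  obtain ⟨φ, hinj, hφ⟩ := exists_injective_mem_of_forall_finset
    (fun x => {s | s ≠ [] ∧ w s ∈ Set.Icc (r * Q x) (Q x)}) (by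
      classical
      intro x T f hf
      have hlt : ∑ s ∈ T.image f, w s < 1 :=
        (Finset.sum_image_le_of_nonneg fun s _ => (hw s).le).trans_lt
          ((Finset.sum_le_sum fun y hy => (hf y hy).2.2).trans_lt (hQfin T))
      obtain ⟨s, hs, hsw, hsF⟩ := exists_weight_mem_Icc_notMem hw hnil hsum hr hchild
        (hQpos x) (hQ1 x) _ hlt
      exact ⟨s, ⟨hs, hsw⟩, fun y hy h => hsF (h ▸ Finset.mem_image_of_mem f hy)⟩)
  refine ⟨φ, hinj, fun x => (hφ x).1, ?_, fun x hx => ?_⟩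
  · calc ∑' x, ENNReal.ofReal (w (φ x)) ≤ ∑' x, ENNReal.ofReal (Q x) :=
          ENNReal.tsum_le_tsum fun x => ENNReal.ofReal_le_ofReal (hφ x).2.2
      _ = ENNReal.ofReal (1 / 2 + a) := by
          rw [← ENNReal.ofReal_tsum_of_nonneg (fun x => (hQpos x).le) hQsum.summable,
            hQsum.tsum_eq]
      _ ≤ 1 := ENNReal.ofReal_le_one.2 (by linarith)
  · have hle : r * (P x / 2) ≤ w (φ x) := by
      refine le_trans (mul_le_mul_of_nonneg_left ?_ hr.le) (hφ x).2.1
      simp only [hQ_def]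
      linarith [hε x]
    have hlog := Real.logb_le_logb_of_le hK1 (by positivity) hle
    rw [Real.logb_mul hr.ne' (by positivity), Real.logb_div hx.ne' two_ne_zero,
      Real.logb_rpow hK0 hK1.ne', Real.logb_rpow hK0 hK1.ne'] at hlog
    have hbound : αc * strCost c (φ x) ≤ -Real.logb K (P x) + Real.logb K 2 + αc * cmax := by
      linarith
    calc strCost c (φ x) = αc * strCost c (φ x) / αc := by field_simp
      _ ≤ (-Real.logb K (P x) + Real.logb K 2 + αc * cmax) / αc := by gcongr
      _ = _ := by field_simp
end
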